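/- arXiv:1602.07456 — 2 statements merged into one kernel-verified Lean document; each statement's English description precedes it below -/
import Mathlib

section
/- Assume p is q²-separable, α₀, α₋, α₊ are nonzero, and either q⁴ ≠ 1 or deg p(z) ≤ 1. Let B := A(p;q)₀ be the degree-zero subalgebra of A(p;q) and let Ω̄ := B·d(B)·B ⊆ Ω be the first-order calculus on B induced from (Ω, d). Then Ω̄ = A(p;q)₂·ω₋ ⊕ A(p;q)₋₂·ω₊ inside Ω; in particular, Ω̄ is isomorphic to A(p;q)₂ ⊕ A(p;q)₋₂ as a B-bimodule. -/
noncomputable section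

open Polynomial
open scoped Classical

namespace GWAPaper

variable (K : Type) [Field K]

/-- Defining relations of the generalized Weyl algebra `A(p;q)`; the generators are
indexed by `Fin 4` with `0 ↦ x₊`, `1 ↦ x₋`, `2 ↦ z₊`, `3 ↦ z₋`. -/
inductive GWARel (q : K) (p : K[X]) :
    FreeAlgebra K (Fin 4) → FreeAlgebra K (Fin 4) → Prop
  | zz : GWARel q p (FreeAlgebra.ι K (2 : Fin 4) * FreeAlgebra.ι K (3 : Fin 4))
      (FreeAlgebra.ι K (3 : Fin 4) * FreeAlgebra.ι K (2 : Fin 4))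
  | xpzp : GWARel q p (FreeAlgebra.ι K (0 : Fin 4) * FreeAlgebra.ι K (2 : Fin 4))
      (q⁻¹ • (FreeAlgebra.ι K (2 : Fin 4) * FreeAlgebra.ι K (0 : Fin 4)))
  | xpzm : GWARel q p (FreeAlgebra.ι K (0 : Fin 4) * FreeAlgebra.ι K (3 : Fin 4))
      (q⁻¹ • (FreeAlgebra.ι K (3 : Fin 4) * FreeAlgebra.ι K (0 : Fin 4)))
  | xmzp : GWARel q p (FreeAlgebra.ι K (1 : Fin 4) * FreeAlgebra.ι K (2 : Fin 4))
      (q • (FreeAlgebra.ι K (2 : Fin 4) * FreeAlgebra.ι K (1 : Fin 4)))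
  | xmzm : GWARel q p (FreeAlgebra.ι K (1 : Fin 4) * FreeAlgebra.ι K (3 : Fin 4))
      (q • (FreeAlgebra.ι K (3 : Fin 4) * FreeAlgebra.ι K (1 : Fin 4)))
  | xpxm : GWARel q p (FreeAlgebra.ι K (0 : Fin 4) * FreeAlgebra.ι K (1 : Fin 4))
      (Polynomial.aeval (FreeAlgebra.ι K (2 : Fin 4) * FreeAlgebra.ι K (3 : Fin 4)) p)
  | xmxp : GWARel q p (FreeAlgebra.ι K (1 : Fin 4) * FreeAlgebra.ι K (0 : Fin 4))
      (Polynomial.aeval ((q ^ 2 : K) • (FreeAlgebra.ι K (3 : Fin 4) * FreeAlgebra.ι K (2 : Fin 4))) p)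

/-- The generalized Weyl algebra `A(p;q)`. -/
abbrev GWA (q : K) (p : K[X]) : Type := RingQuot (GWARel K q p)

/-- The images of the four generators in `A(p;q)`. -/
def gwaGen (q : K) (p : K[X]) (i : Fin 4) : GWA K q p :=
  RingQuot.mkAlgHom K (GWARel K q p) (FreeAlgebra.ι K i)

/-- The generator `x₊`. -/
def xp (q : K) (p : K[X]) : GWA K q p := gwaGen K q p 0
/-- The generator `x₋`. -/
def xm (q : K) (p : K[X]) : GWA K q p := gwaGen K q p 1
/-- The generator `z₊`. -/
def zp (q : K) (p : K[X]) : GWA K q p := gwaGen K q p 2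
/-- The generator `z₋`. -/
def zm (q : K) (p : K[X]) : GWA K q p := gwaGen K q p 3

/-- ℤ-degrees of the generators: `deg x₊ = deg z₊ = 1`, `deg x₋ = deg z₋ = -1`. -/
def gwaWt : Fin 4 → ℤ := ![1, -1, 1, -1]

/-- The total degree of a word in the generators. -/
def wordDeg (w : List (Fin 4)) : ℤ := (w.map gwaWt).sum

/-- The product in `A(p;q)` of the letters of a word. -/
def wordVal (q : K) (p : K[X]) (w : List (Fin 4)) : GWA K q p :=
  (w.map (gwaGen K q p)).prod

/-- The degree-`n` homogeneous component of the ℤ-graded algebra `A(p;q)`: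
the `K`-linear span of the values of all words of total degree `n`. -/
def component (q : K) (p : K[X]) (n : ℤ) : Submodule K (GWA K q p) :=
  Submodule.span K {a | ∃ w : List (Fin 4), wordDeg w = n ∧ wordVal K q p w = a}

/-- The `q²`-derivative `p_{q²}` of a polynomial `p`, equal to
`(p(q²z) - p(z))/((q²-1)z)` if `q² ≠ 1` and to `p'` if `q² = 1`. -/
def qDeriv (q : K) (p : K[X]) : K[X] :=
  if q ^ 2 = 1 then derivative p
  else (p.comp (C (q ^ 2) * X) - p) / (C (q ^ 2 - 1) * X)

/-- The polynomial `c(z) = q·p_{q²}(z)`. -/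
def cPoly (q : K) (p : K[X]) : K[X] := C q * qDeriv K q p

/-- `p` is `q²`-separable: `p(z)` is coprime with `z·p_{q²}(z)`. -/
def QSeparable (q : K) (p : K[X]) : Prop := IsCoprime p (X * qDeriv K q p)

/-- The right `A(p;q)`-action on the free left module `Ω = A(p;q)³` with basis
`ω₋, ω₀, ω₊` (coordinates `0, 1, 2`), twisted by the automorphisms `σ₋ = σ₊` and `σ₀`:
`ω₋·a = σ₋(a)·ω₋`, `ω₀·a = σ₀(a)·ω₀`, `ω₊·a = σ₊(a)·ω₊`. -/
def rAct (q : K) (p : K[X]) (σm σ0 : GWA K q p ≃ₐ[K] GWA K q p)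
    (ω : Fin 3 → GWA K q p) (a : GWA K q p) : Fin 3 → GWA K q p :=
  ![ω 0 * σm a, ω 1 * σ0 a, ω 2 * σm a]


section Relations

variable {K}
variable {A : Type*} [Ring A] [Algebra K A]

/-- The elements `x, y, z, w` (in the roles of `x₊, x₋, z₊, z₋`) satisfy the defining relations
of `A(p;q)`. -/
structure IsGWATuple (q : K) (p : K[X]) (x y z w : A) : Prop where
  zw : z * w = w * z
  xz : x * z = q⁻¹ • (z * x)
  xw : x * w = q⁻¹ • (w * x)
  yz : y * z = q • (z * y)
  yw : y * w = q • (w * y)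
  xy : x * y = aeval (z * w) p
  yx : y * x = aeval (q ^ 2 • (w * z)) p

theorem mul_pow_of_skew_comm {r : K} {x z : A} (h : x * z = r • (z * x)) (n : ℕ) :
    x * z ^ n = r ^ n • (z ^ n * x) := by
  induction n with
  | zero => simp
  | succ n ih =>
    rw [pow_succ, ← mul_assoc, ih, smul_mul_assoc, mul_assoc, h, mul_smul_comm, smul_smul,
      ← pow_succ, mul_assoc]

theorem pow_mul_of_skew_comm {r : K} {x z : A} (h : x * z = r • (z * x)) (n : ℕ) :
    x ^ n * z = r ^ n • (z * x ^ n) := by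
  induction n with
  | zero => simp
  | succ n ih =>
    rw [pow_succ, mul_assoc, h, mul_smul_comm, ← mul_assoc, ih, smul_mul_assoc, smul_smul,
      ← pow_succ', mul_assoc]

theorem mul_pow_mul_pow_of_skew_comm {r : K} {x z w : A} (h : x * z = r • (z * x))
    (h' : x * w = r • (w * x)) (i j : ℕ) :
    x * (z ^ i * w ^ j) = r ^ (i + j) • (z ^ i * w ^ j * x) := by
  rw [← mul_assoc, mul_pow_of_skew_comm h, smul_mul_assoc, mul_assoc, mul_pow_of_skew_comm h',
    mul_smul_comm, smul_smul, pow_add, mul_assoc]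

/-- The span of the ordered monomials of degree `n`. -/
def orderedSpan (K : Type) [Field K] {A : Type*} [Ring A] [Algebra K A] (x y z w : A) (n : ℤ) :
    Submodule K A :=
  Submodule.span K {a | ∃ i j k : ℕ, ((i : ℤ) - j + k = n ∧ a = z ^ i * w ^ j * x ^ k) ∨
    ((i : ℤ) - j - k = n ∧ a = z ^ i * w ^ j * y ^ k)}

variable {q : K} {p : K[X]} {x y z w : A}

theorem mem_orderedSpan_left (i j k : ℕ) {n : ℤ} (h : (i : ℤ) - j + k = n) :
    z ^ i * w ^ j * x ^ k ∈ orderedSpan K x y z w n :=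
  Submodule.subset_span ⟨i, j, k, Or.inl ⟨h, rfl⟩⟩

theorem mem_orderedSpan_right (i j k : ℕ) {n : ℤ} (h : (i : ℤ) - j - k = n) :
    z ^ i * w ^ j * y ^ k ∈ orderedSpan K x y z w n :=
  Submodule.subset_span ⟨i, j, k, Or.inr ⟨h, rfl⟩⟩

theorem mul_aeval_mul_mem_of_commute (hzw : z * w = w * z) (f : K[X]) (i j : ℕ) (t : A)
    (S : Submodule K A) (h : ∀ m : ℕ, z ^ (i + m) * w ^ (j + m) * t ∈ S) :
    z ^ i * w ^ j * (aeval (z * w) f * t) ∈ S := by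
  rw [aeval_eq_sum_range, Finset.sum_mul, Finset.mul_sum]
  refine Submodule.sum_mem _ fun m _ ↦ ?_
  have hc : Commute z w := hzw
  have e : z ^ i * w ^ j * (z * w) ^ m = z ^ (i + m) * w ^ (j + m) := by
    rw [hc.mul_pow, mul_assoc, ← mul_assoc (w ^ j), ((hc.pow_pow m j).eq).symm, pow_add, pow_add]
    simp only [mul_assoc]
  rw [smul_mul_assoc, mul_smul_comm, ← mul_assoc, e]
  exact S.smul_mem _ (h m)

theorem IsGWATuple.yx_eq (h : IsGWATuple q p x y z w) :
    y * x = aeval (z * w) (p.comp (C (q ^ 2) * X)) := by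
  rw [h.yx, aeval_comp, h.zw]
  simp [Algebra.smul_def]

theorem IsGWATuple.mul_mem_orderedSpan (h : IsGWATuple q p x y z w) {n : ℤ} {a : A}
    (ha : a ∈ orderedSpan K x y z w n) :
    x * a ∈ orderedSpan K x y z w (1 + n) ∧ y * a ∈ orderedSpan K x y z w (-1 + n) ∧
      z * a ∈ orderedSpan K x y z w (1 + n) ∧ w * a ∈ orderedSpan K x y z w (-1 + n) := by
  have hw (i j : ℕ) (t : A) : w * (z ^ i * w ^ j * t) = z ^ i * w ^ (j + 1) * t := by
    have hc : Commute w z := h.zw.symm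
    rw [← mul_assoc, ← mul_assoc, (hc.pow_right i).eq, pow_succ', mul_assoc (z ^ i)]
  have hz (i j : ℕ) (t : A) : z * (z ^ i * w ^ j * t) = z ^ (i + 1) * w ^ j * t := by
    rw [pow_succ']; simp only [mul_assoc]
  have hx (i j : ℕ) (t : A) :
      x * (z ^ i * w ^ j * t) = q⁻¹ ^ (i + j) • (z ^ i * w ^ j * (x * t)) := by
    rw [← mul_assoc, mul_pow_mul_pow_of_skew_comm h.xz h.xw, smul_mul_assoc, mul_assoc]
  have hy (i j : ℕ) (t : A) :
      y * (z ^ i * w ^ j * t) = q ^ (i + j) • (z ^ i * w ^ j * (y * t)) := by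
    rw [← mul_assoc, mul_pow_mul_pow_of_skew_comm h.yz h.yw, smul_mul_assoc, mul_assoc]
  induction ha using Submodule.span_induction with
  | mem a ha =>
    obtain ⟨i, j, k, ⟨hn, rfl⟩ | ⟨hn, rfl⟩⟩ := ha
    · rw [hx, hy, hz, hw, ← pow_succ']
      refine ⟨Submodule.smul_mem _ _ (mem_orderedSpan_left _ _ _ (by push_cast; linarith)),
        Submodule.smul_mem _ _ ?_, mem_orderedSpan_left _ _ _ (by push_cast; linarith),
        mem_orderedSpan_left _ _ _ (by push_cast; linarith)⟩
      cases k with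
      | zero =>
        rw [pow_zero, mul_one]
        have := mem_orderedSpan_right (K := K) (x := x) (y := y) (z := z) (w := w) i j 1
          (n := -1 + n) (by push_cast at hn ⊢; linarith)
        rwa [pow_one] at this
      | succ k =>
        rw [pow_succ', ← mul_assoc y, h.yx_eq]
        exact mul_aeval_mul_mem_of_commute h.zw _ _ _ _ _ fun m ↦
          mem_orderedSpan_left _ _ _ (by push_cast at hn ⊢; linarith)
    · rw [hx, hy, hz, hw, ← pow_succ']
      refine ⟨Submodule.smul_mem _ _ ?_,
        Submodule.smul_mem _ _ (mem_orderedSpan_right _ _ _ (by push_cast; linarith)),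
        mem_orderedSpan_right _ _ _ (by push_cast; linarith),
        mem_orderedSpan_right _ _ _ (by push_cast; linarith)⟩
      cases k with
      | zero =>
        rw [pow_zero, mul_one]
        have := mem_orderedSpan_left (K := K) (x := x) (y := y) (z := z) (w := w) i j 1
          (n := 1 + n) (by push_cast at hn ⊢; linarith)
        rwa [pow_one] at this
      | succ k =>
        rw [pow_succ', ← mul_assoc x, h.xy]
        exact mul_aeval_mul_mem_of_commute h.zw _ _ _ _ _ fun m ↦
          mem_orderedSpan_right _ _ _ (by push_cast at hn ⊢; linarith)
  | zero => simp
  | add a b _ _ ha hb =>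
    simp only [mul_add]
    exact ⟨add_mem ha.1 hb.1, add_mem ha.2.1 hb.2.1, add_mem ha.2.2.1 hb.2.2.1,
      add_mem ha.2.2.2 hb.2.2.2⟩
  | smul r a _ ha =>
    simp only [mul_smul_comm]
    exact ⟨Submodule.smul_mem _ _ ha.1, Submodule.smul_mem _ _ ha.2.1,
      Submodule.smul_mem _ _ ha.2.2.1, Submodule.smul_mem _ _ ha.2.2.2⟩

/-- Degree two is generated by `x²`, `zx`, `z²` over degree zero. -/
theorem IsGWATuple.orderedSpan_two_le (hq : q ≠ 0) (h : IsGWATuple q p x y z w)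
    (T : Submodule K A)
    (hT : ∀ b ∈ orderedSpan K x y z w 0, ∀ t ∈ T, b * t ∈ T)
    (hxx : x * x ∈ T) (hzx : z * x ∈ T) (hzz : z * z ∈ T) :
    orderedSpan K x y z w 2 ≤ T := by
  have hc : Commute z w := h.zw
  refine Submodule.span_le.2 ?_
  rintro _ ⟨i, j, k, ⟨hn, rfl⟩ | ⟨hn, rfl⟩⟩
  · rcases k with _ | _ | k
    · obtain rfl : i = j + 2 := by push_cast at hn; omega
      have e : z ^ (j + 2) * w ^ j * x ^ 0 = z ^ j * w ^ j * x ^ 0 * (z * z) := by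
        rw [pow_zero, mul_one, mul_one, pow_add, pow_two, mul_assoc (z ^ j),
          ((hc.mul_left hc).pow_right j).eq, mul_assoc]
      rw [e]
      exact hT _ (mem_orderedSpan_left _ _ _ (by simp)) _ hzz
    · obtain rfl : i = j + 1 := by push_cast at hn; omega
      have e : z ^ (j + 1) * w ^ j * x ^ (0 + 1) = z ^ j * w ^ j * x ^ 0 * (z * x) := by
        rw [pow_zero, mul_one, zero_add, pow_one, pow_succ, mul_assoc (z ^ j),
          (hc.pow_right j).eq]
        simp only [mul_assoc]
      rw [e]
      exact hT _ (mem_orderedSpan_left _ _ _ (by simp)) _ hzx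
    · have e : z ^ i * w ^ j * x ^ (k + 1 + 1) = z ^ i * w ^ j * x ^ k * (x * x) := by
        rw [pow_succ, pow_succ]; simp only [mul_assoc]
      rw [e]
      exact hT _ (mem_orderedSpan_left _ _ _ (by push_cast at hn; linarith)) _ hxx
  · obtain ⟨i, rfl⟩ : ∃ i', i = i' + 2 := ⟨i - 2, by omega⟩
    have e : z ^ (i + 2) * w ^ j * y ^ k =
        ((q ^ 2) ^ k)⁻¹ • (z ^ i * w ^ j * y ^ k * (z * z)) := by
      have hy : y ^ k * (z * z) = (q ^ 2) ^ k • (z * z * y ^ k) := by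
        rw [← pow_two z]
        exact pow_mul_of_skew_comm (mul_pow_of_skew_comm h.yz 2) k
      rw [mul_assoc _ (y ^ k), hy, mul_smul_comm, smul_smul,
        inv_mul_cancel₀ (pow_ne_zero _ (pow_ne_zero _ hq)), one_smul, pow_add, pow_two,
        mul_assoc (z ^ i), ((hc.mul_left hc).pow_right j).eq]
      simp only [mul_assoc]
    rw [e]
    refine T.smul_mem _ (hT _ (mem_orderedSpan_right _ _ _ (by push_cast at hn; linarith)) _ hzz)

theorem orderedSpan_neg_le_swap (hzw : z * w = w * z) (n : ℤ) :
    orderedSpan K x y z w (-n) ≤ orderedSpan K y x w z n := by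
  have hc (i j : ℕ) : z ^ i * w ^ j = w ^ j * z ^ i :=
    ((show Commute z w from hzw).pow_pow i j).eq
  refine Submodule.span_le.2 ?_
  rintro _ ⟨i, j, k, ⟨hn, rfl⟩ | ⟨hn, rfl⟩⟩
  · rw [hc]
    exact mem_orderedSpan_right _ _ _ (by linarith)
  · rw [hc]
    exact mem_orderedSpan_left _ _ _ (by linarith)

theorem IsGWATuple.swap (hq : q ≠ 0) (h : IsGWATuple q p x y z w) :
    IsGWATuple q⁻¹ (p.comp (C (q ^ 2) * X)) y x w z where
  zw := h.zw.symm
  xz := by rw [inv_inv, h.yw]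
  xw := by rw [inv_inv, h.yz]
  yz := h.xw
  yw := h.xz
  xy := by rw [h.yx_eq, h.zw]
  yx := by
    rw [h.xy, aeval_comp]
    congr 2
    simp only [map_mul, aeval_C, aeval_X, ← Algebra.smul_def]
    rw [smul_smul, ← mul_pow, mul_inv_cancel₀ hq, one_pow, one_smul]

theorem commute_aeval_of_commute {a v : A} (h : Commute a v) (f : K[X]) :
    Commute a (aeval v f) := by
  rw [aeval_eq_sum_range]
  exact Commute.sum_right _ _ _ fun i _ ↦ (h.pow_right i).smul_right _

theorem qDeriv_C_mul_X_add_C (q a b : K) : qDeriv K q (C a * X + C b) = C a := by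
  unfold qDeriv
  split_ifs with h
  · simp
  · have h' : C (q ^ 2 - 1) * X ≠ (0 : K[X]) :=
      mul_ne_zero (C_ne_zero.2 (sub_ne_zero.2 h)) X_ne_zero
    have e : (C a * X + C b).comp (C (q ^ 2) * X) - (C a * X + C b) =
        C (q ^ 2 - 1) * X * C a := by
      simp only [add_comp, mul_comp, C_comp, X_comp, map_sub, map_one]
      ring
    rw [e, mul_div_cancel_left₀ _ h']

theorem QSeparable.eval_zero_ne_zero (h : QSeparable K q p) : p.eval 0 ≠ 0 := by
  obtain ⟨f, g, hfg⟩ := h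
  intro h0
  simpa [h0] using congrArg (eval 0) hfg

/-- The differentials of `zw` and of `xw` separate the two summands at `zx`. -/
theorem IsGWATuple.zx_mem (hq : q ≠ 0) (h : IsGWATuple q p x y z w)
    (hsep : QSeparable K q p) (hq4 : q ^ 4 ≠ 1 ∨ p.natDegree ≤ 1)
    (B : Subalgebra K A) (hBzw : z * w ∈ B) (hBzy : z * y ∈ B)
    (P : Submodule K (A × A))
    (hl : ∀ b ∈ B, ∀ m n, (m, n) ∈ P → (b * m, b * n) ∈ P)
    (hr : ∀ b ∈ B, ∀ m n, (m, n) ∈ P → (m * b, n * b) ∈ P)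
    {αm αp : K} (hαm : αm ≠ 0) (hαp : αp ≠ 0)
    (hdzw : (αm • (z * x), αp • (w * y)) ∈ P)
    (hdxw : (αm • (x * x), (αp * q⁻¹) • (aeval (z * w) (cPoly K q p) * (w * w))) ∈ P) :
    (z * x, 0) ∈ P := by
  set v := z * w with hv
  set c := aeval v (cPoly K q p) with hcdef
  have hzv : Commute z v := (Commute.refl z).mul_right h.zw
  have hwv : Commute w v := (show Commute w z from h.zw.symm).mul_right (Commute.refl w)
  have hBf (f : K[X]) : aeval v f ∈ B :=
    Algebra.adjoin_le (Set.singleton_subset_iff.2 hBzw) (aeval_mem_adjoin_singleton K v)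
  have hxv : z * x * v = q⁻¹ ^ 2 • (v * (z * x)) := by
    have := mul_pow_mul_pow_of_skew_comm h.xz h.xw 1 1
    rw [pow_one, pow_one, ← hv] at this
    rw [mul_assoc, this, mul_smul_comm, ← mul_assoc, hzv.eq, mul_assoc]
  have hyv : w * y * v = q ^ 2 • (v * (w * y)) := by
    have := mul_pow_mul_pow_of_skew_comm h.yz h.yw 1 1
    rw [pow_one, pow_one, ← hv] at this
    rw [mul_assoc, this, mul_smul_comm, ← mul_assoc, hwv.eq, mul_assoc]
  set p₂ := p.comp (C (q ^ 2) * X) with hp₂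
  have key : (αm • (aeval v p₂ * (z * x)), (αp * q⁻¹) • (w * y * (v * c))) ∈ P := by
    have h1 := hl _ hBzy _ _ hdxw
    have e1 : z * y * (αm • (x * x)) = αm • (aeval v p₂ * (z * x)) := by
      rw [mul_smul_comm, mul_assoc, ← mul_assoc y, h.yx_eq, ← mul_assoc z,
        (commute_aeval_of_commute hzv _).eq, mul_assoc]
    have e2 : z * y * ((αp * q⁻¹) • (c * (w * w))) = (αp * q⁻¹) • (w * y * (v * c)) := by
      have hwc : w * c = c * w := (commute_aeval_of_commute hwv _).eq
      have hvc : v * c = c * v := (commute_aeval_of_commute (Commute.refl v) _).eq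
      have hzc : z * c = c * z := (commute_aeval_of_commute hzv _).eq
      have ezy : z * y = q⁻¹ • (y * z) := by rw [h.yz, inv_smul_smul₀ hq]
      have ewy : w * y = q⁻¹ • (y * w) := by rw [h.yw, inv_smul_smul₀ hq]
      have e : z * (c * (w * w)) = w * (v * c) := by
        rw [← mul_assoc, hzc, mul_assoc, ← mul_assoc z, ← hv, ← hwv.eq, ← mul_assoc c, ← hwc,
          mul_assoc, hvc]
      rw [mul_smul_comm, ezy, ewy, smul_mul_assoc, smul_mul_assoc, mul_assoc, e, mul_assoc y w]
    rwa [e1, e2] at h1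
  have hright := hr v hBzw _ _ hdzw
  have hleft := hl v hBzw _ _ hdzw
  rw [smul_mul_assoc, smul_mul_assoc] at hright
  rw [mul_smul_comm, mul_smul_comm] at hleft
  have hp0 := hsep.eval_zero_ne_zero
  by_cases hq' : q ^ 4 = 1
  · obtain ⟨a, b, rfl⟩ := exists_eq_X_add_C_of_natDegree_le_one (hq4.resolve_left (not_not.2 hq'))
    have hb : b ≠ 0 := by simpa using hp0
    have hc : c = (q * a) • (1 : A) := by
      rw [hcdef, cPoly, qDeriv_C_mul_X_add_C, ← C_mul, aeval_C, Algebra.algebraMap_eq_smul_one]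
    have hpv : aeval v p₂ = (a * q ^ 2) • v + b • (1 : A) := by
      simp [hp₂, Algebra.smul_def]
      simp [mul_assoc]
    have h1 := P.sub_mem key (P.smul_mem a hright)
    rw [hc, hpv, hxv, hyv, Prod.smul_mk, Prod.mk_sub_mk] at h1
    have hqi : q⁻¹ ^ 2 = q ^ 2 := by
      field_simp
      rw [hq']
    refine (P.smul_mem_iff (mul_ne_zero hαm hb)).1 ?_
    convert h1 using 1
    rw [Prod.smul_mk, smul_zero, hqi, mul_smul_comm, mul_one, mul_smul_comm, hyv]
    congr 1
    · rw [add_mul, smul_mul_assoc, smul_mul_assoc, one_mul]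
      module
    · match_scalars
      field_simp
      ring
  · have hd : q ^ 2 - q⁻¹ ^ 2 ≠ 0 := by
      intro h0
      apply hq'
      field_simp at h0
      linear_combination h0
    have hv1 : (v * (z * x), 0) ∈ P := by
      have h1 := P.sub_mem (P.smul_mem (q ^ 2) hleft) hright
      refine (P.smul_mem_iff (mul_ne_zero hαm hd)).1 ?_
      convert h1 using 1
      rw [hxv, hyv, Prod.smul_mk, Prod.smul_mk, Prod.mk_sub_mk]
      congr 1 <;> module
    have hv2 : (0, w * y * v) ∈ P := by
      have h1 := P.sub_mem hright (P.smul_mem (q⁻¹ ^ 2) hleft)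
      refine (P.smul_mem_iff
        (mul_ne_zero (mul_ne_zero hαp hd) (pow_ne_zero 2 (inv_ne_zero hq)))).1 ?_
      convert h1 using 1
      rw [hxv, hyv, Prod.smul_mk, Prod.smul_mk, Prod.mk_sub_mk]
      congr 1
      · module
      · match_scalars
        field_simp
    have hvc := hr c (hBf _) _ _ hv2
    rw [zero_mul, mul_assoc] at hvc
    have h1 := P.sub_mem key (P.smul_mem (αp * q⁻¹) hvc)
    have h2 := P.sub_mem h1 (P.smul_mem αm (hl _ (hBf p₂.divX) _ _ hv1))
    refine (P.smul_mem_iff (mul_ne_zero hαm hp0)).1 ?_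
    convert h2 using 1
    have hpv : aeval v p₂ = aeval v p₂.divX * v + p.eval 0 • (1 : A) := by
      conv_lhs => rw [← divX_mul_X_add p₂]
      rw [map_add, map_mul, aeval_X, aeval_C, coeff_zero_eq_eval_zero, hp₂, eval_comp]
      simp [Algebra.algebraMap_eq_smul_one]
    rw [hpv]
    simp only [Prod.smul_mk, Prod.mk_sub_mk, add_mul, smul_mul_assoc, one_mul, mul_zero,
      smul_zero, sub_zero, sub_self, mul_assoc, smul_add, add_sub_cancel_left, smul_smul]

theorem QSeparable.mem_of_mem (h : QSeparable K q p) (hq : q ≠ 0) {v t : A} (T : Submodule K A)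
    (hT : ∀ f : K[X], ∀ s ∈ T, aeval v f * s ∈ T)
    (h1 : aeval v p * t ∈ T) (h2 : v * (aeval v (cPoly K q p) * t) ∈ T) : t ∈ T := by
  obtain ⟨f, g, hfg⟩ := h
  have h3 := T.add_mem (hT f _ h1) (T.smul_mem q⁻¹ (hT g _ h2))
  convert h3 using 1
  have e : aeval v (f * p + g * (X * qDeriv K q p)) = (1 : A) := by rw [hfg, map_one]
  have e2 : aeval v (cPoly K q p) = q • aeval v (qDeriv K q p) := by
    rw [cPoly, map_mul, aeval_C, Algebra.smul_def]
  conv_lhs => rw [← one_mul t, ← e]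
  rw [e2]
  simp only [map_add, map_mul, aeval_X, add_mul, smul_mul_assoc, mul_smul_comm, mul_assoc,
    inv_smul_smul₀ hq]

/-- The differentials of `zw`, `xw` and `zy` generate all six quadratic elements. -/
theorem IsGWATuple.quadratic_mem (hq : q ≠ 0) (h : IsGWATuple q p x y z w)
    (hsep : QSeparable K q p) (hq4 : q ^ 4 ≠ 1 ∨ p.natDegree ≤ 1)
    (B : Subalgebra K A) (hBzw : z * w ∈ B) (hBzy : z * y ∈ B) (hBxw : x * w ∈ B)
    (P : Submodule K (A × A))
    (hl : ∀ b ∈ B, ∀ m n, (m, n) ∈ P → (b * m, b * n) ∈ P)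
    (hr : ∀ b ∈ B, ∀ m n, (m, n) ∈ P → (m * b, n * b) ∈ P)
    {αm αp : K} (hαm : αm ≠ 0) (hαp : αp ≠ 0)
    (hdzw : (αm • (z * x), αp • (w * y)) ∈ P)
    (hdxw : (αm • (x * x), (αp * q⁻¹) • (aeval (z * w) (cPoly K q p) * (w * w))) ∈ P)
    (hdzy : (αm • (aeval (z * w) (cPoly K q p) * (z * z)), (αp * q⁻¹) • (y * y)) ∈ P) :
    ((z * x, 0) ∈ P ∧ (x * x, 0) ∈ P ∧ (z * z, 0) ∈ P) ∧
      (0, w * y) ∈ P ∧ (0, y * y) ∈ P ∧ (0, w * w) ∈ P := by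
  have hzx := h.zx_mem hq hsep hq4 B hBzw hBzy P hl hr hαm hαp hdzw hdxw
  have hαp' : αp * q⁻¹ ≠ 0 := mul_ne_zero hαp (inv_ne_zero hq)
  have hfst {m n : A} (h1 : (m, n) ∈ P) (h2 : (0, n) ∈ P) : (m, 0) ∈ P := by
    simpa using P.sub_mem h1 h2
  have hsnd {m n : A} (h1 : (m, n) ∈ P) (h2 : (m, 0) ∈ P) : (0, n) ∈ P := by
    simpa using P.sub_mem h1 h2
  have hs1 {r : K} (hr : r ≠ 0) {m : A} : (r • m, 0) ∈ P ↔ (m, 0) ∈ P := by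
    rw [← P.smul_mem_iff hr (x := (m, 0)), Prod.smul_mk, smul_zero]
  have hs2 {r : K} (hr : r ≠ 0) {m : A} : (0, r • m) ∈ P ↔ (0, m) ∈ P := by
    rw [← P.smul_mem_iff hr (x := (0, m)), Prod.smul_mk, smul_zero]
  have hl1 {b m : A} (hb : b ∈ B) (hm : (m, 0) ∈ P) : (b * m, 0) ∈ P := by
    simpa using hl b hb _ _ hm
  have hl2 {b m : A} (hb : b ∈ B) (hm : (0, m) ∈ P) : (0, b * m) ∈ P := by
    simpa using hl b hb _ _ hm
  have hr1 {b m : A} (hb : b ∈ B) (hm : (m, 0) ∈ P) : (m * b, 0) ∈ P := by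
    simpa using hr b hb _ _ hm
  have hwy : (0, w * y) ∈ P := (hs2 hαp).1 (hsnd hdzw ((hs1 hαm).2 hzx))
  have hBf (f : K[X]) : aeval (z * w) f ∈ B :=
    Algebra.adjoin_le (Set.singleton_subset_iff.2 hBzw) (aeval_mem_adjoin_singleton K _)
  have hzv : Commute z (z * w) := (Commute.refl z).mul_right h.zw
  have hwv : Commute w (z * w) := (show Commute w z from h.zw.symm).mul_right (Commute.refl w)
  have hpz := (commute_aeval_of_commute hzv p).eq
  have hpw := (commute_aeval_of_commute hwv p).eq
  have hqi : q⁻¹ ≠ 0 := inv_ne_zero hq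
  have hww : (0, w * w) ∈ P := by
    refine hsep.mem_of_mem hq (P.comap (LinearMap.inr K A A)) (v := z * w)
      (fun f s hs ↦ hl2 (hBf f) hs) ?_ ?_
    · have h1 : x * w * (w * y) = (q⁻¹ * q⁻¹) • (aeval (z * w) p * (w * w)) := by
        rw [← mul_assoc, mul_assoc x, ← pow_two w, mul_pow_of_skew_comm h.xw, smul_mul_assoc,
          mul_assoc, h.xy, pow_two w, mul_assoc, hpw, ← mul_assoc, hpw, mul_assoc, pow_two]
      exact (hs2 (mul_ne_zero hqi hqi)).1 (h1 ▸ hl2 hBxw hwy)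
    · have h1 : z * x * (x * w) = (q⁻¹ * q⁻¹) • (z * w * (x * x)) := by
        rw [← mul_assoc, mul_assoc z, ← pow_two x, mul_assoc, pow_mul_of_skew_comm h.xw,
          mul_smul_comm, pow_two q⁻¹, mul_assoc]
      have h2 : (z * w * (x * x), 0) ∈ P :=
        (hs1 (mul_ne_zero hqi hqi)).1 (h1 ▸ hr1 hBxw hzx)
      have h3 := hl _ hBzw _ _ hdxw
      rw [mul_smul_comm, mul_smul_comm] at h3
      exact (hs2 hαp').1 (hsnd h3 ((hs1 hαm).2 h2))
  have hzz : (z * z, 0) ∈ P := by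
    refine hsep.mem_of_mem hq (P.comap (LinearMap.inl K A A)) (v := z * w)
      (fun f s hs ↦ hl1 (hBf f) hs) ?_ ?_
    · have h1 : z * x * (z * y) = q⁻¹ • (aeval (z * w) p * (z * z)) := by
        rw [mul_assoc, ← mul_assoc x, h.xz, smul_mul_assoc, mul_smul_comm, mul_assoc z x, h.xy,
          hpz, ← mul_assoc, hpz, mul_assoc]
      have := hr1 hBzy hzx
      rw [h1] at this
      exact (hs1 hqi).1 this
    · have h1 : z * y * (w * y) = q • (z * w * (y * y)) := by
        rw [mul_assoc, ← mul_assoc y, h.yw, smul_mul_assoc, mul_smul_comm, mul_assoc w, mul_assoc]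
      have h2 : (0, z * w * (y * y)) ∈ P := (hs2 hq).1 (h1 ▸ hl2 hBzy hwy)
      have h3 := hl _ hBzw _ _ hdzy
      rw [mul_smul_comm, mul_smul_comm] at h3
      exact (hs1 hαm).1 (hfst h3 ((hs2 hαp').2 h2))
  exact ⟨⟨hzx, (hs1 hαm).1 (hfst hdxw ((hs2 hαp').2 (hl2 (hBf _) hww))), hzz⟩, hwy,
    (hs2 hαp').1 (hsnd hdzy ((hs1 hαm).2 (hl1 (hBf _) hzz))), hww⟩

/-- The span of the pairs `(b · D b' · b'', b · D' b' · b'')` with `b, b', b''` in `B`. -/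
def bimoduleSpan (B : Subalgebra K A) (D D' : A →ₗ[K] A) : Submodule K (A × A) :=
  Submodule.span K {t | ∃ a ∈ B, ∃ b ∈ B, ∃ c ∈ B, t = (a * D b * c, a * D' b * c)}

theorem mul_mul_mem_bimoduleSpan {B : Subalgebra K A} {D D' : A →ₗ[K] A} {b c : A} (hb : b ∈ B)
    (hc : c ∈ B) {t : A × A} (ht : t ∈ bimoduleSpan B D D') :
    (b * t.1 * c, b * t.2 * c) ∈ bimoduleSpan B D D' := by
  induction ht using Submodule.span_induction with
  | mem t ht =>
    obtain ⟨a, ha, d, hd, e, he, rfl⟩ := ht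
    exact Submodule.subset_span
      ⟨b * a, B.mul_mem hb ha, d, hd, e * c, B.mul_mem he hc, by simp only [mul_assoc]⟩
  | zero =>
    simp only [Prod.fst_zero, Prod.snd_zero, mul_zero, zero_mul]
    exact zero_mem _
  | add s t _ _ hs ht => simpa [mul_add, add_mul] using add_mem hs ht
  | smul r s _ hs => simpa using Submodule.smul_mem _ r hs

theorem mul_mem_bimoduleSpan_left {B : Subalgebra K A} {D D' : A →ₗ[K] A} {b : A} (hb : b ∈ B)
    {m n : A} (h : (m, n) ∈ bimoduleSpan B D D') : (b * m, b * n) ∈ bimoduleSpan B D D' := by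
  simpa using mul_mul_mem_bimoduleSpan hb B.one_mem h

theorem mul_mem_bimoduleSpan_right {B : Subalgebra K A} {D D' : A →ₗ[K] A} {b : A} (hb : b ∈ B)
    {m n : A} (h : (m, n) ∈ bimoduleSpan B D D') : (m * b, n * b) ∈ bimoduleSpan B D D' := by
  simpa using mul_mul_mem_bimoduleSpan B.one_mem hb h

theorem differential_mem_bimoduleSpan {B : Subalgebra K A} (D D' : A →ₗ[K] A) {b : A}
    (hb : b ∈ B) : (D b, D' b) ∈ bimoduleSpan B D D' :=
  Submodule.subset_span ⟨1, B.one_mem, b, hb, 1, B.one_mem, by simp⟩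

theorem IsGWATuple.quadratic_mem_bimoduleSpan (hq : q ≠ 0) (h : IsGWATuple q p x y z w)
    (hsep : QSeparable K q p) (hq4 : q ^ 4 ≠ 1 ∨ p.natDegree ≤ 1)
    (B : Subalgebra K A) (hBzw : z * w ∈ B) (hBzy : z * y ∈ B) (hBxw : x * w ∈ B)
    {αm αp : K} (hαm : αm ≠ 0) (hαp : αp ≠ 0)
    (σ : A ≃ₐ[K] A) (hσy : σ y = q⁻¹ • y) (hσw : σ w = q⁻¹ • w)
    (Dm Dp : A →ₗ[K] A)
    (hDm : ∀ a b, Dm (a * b) = Dm a * σ b + a * Dm b)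
    (hDmx : Dm x = 0) (hDmz : Dm z = 0)
    (hDmy : Dm y = αm • (aeval (z * w) (cPoly K q p) * z)) (hDmw : Dm w = αm • x)
    (hDp : ∀ a b, Dp (a * b) = Dp a * σ b + a * Dp b)
    (hDpy : Dp y = 0) (hDpw : Dp w = 0)
    (hDpx : Dp x = αp • (aeval (z * w) (cPoly K q p) * w)) (hDpz : Dp z = αp • y) :
    ((z * x, 0) ∈ bimoduleSpan B Dm Dp ∧ (x * x, 0) ∈ bimoduleSpan B Dm Dp ∧
        (z * z, 0) ∈ bimoduleSpan B Dm Dp) ∧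
      (0, w * y) ∈ bimoduleSpan B Dm Dp ∧ (0, y * y) ∈ bimoduleSpan B Dm Dp ∧
        (0, w * w) ∈ bimoduleSpan B Dm Dp := by
  have hcz := (commute_aeval_of_commute
    ((Commute.refl z).mul_right (show Commute z w from h.zw)) (cPoly K q p)).eq
  have hdzw := differential_mem_bimoduleSpan Dm Dp hBzw
  have hdxw := differential_mem_bimoduleSpan Dm Dp hBxw
  have hdzy := differential_mem_bimoduleSpan Dm Dp hBzy
  rw [hDm, hDp, hDmz, hDmw, hDpz, hDpw, zero_mul, zero_add, mul_zero, add_zero, hσw,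
    mul_smul_comm, smul_mul_assoc, mul_smul_comm, h.yw, inv_smul_smul₀ hq] at hdzw
  rw [hDm, hDp, hDmx, hDmw, hDpx, hDpw, zero_mul, zero_add, mul_zero, add_zero, hσw,
    mul_smul_comm, smul_mul_assoc, mul_smul_comm, smul_smul αp, mul_assoc _ w] at hdxw
  rw [hDm, hDp, hDmz, hDmy, hDpz, hDpy, zero_mul, zero_add, mul_zero, add_zero, hσy,
    mul_smul_comm, smul_mul_assoc, mul_smul_comm, smul_smul αp, ← mul_assoc z, hcz,
    mul_assoc _ z] at hdzy
  exact h.quadratic_mem hq hsep hq4 B hBzw hBzy hBxw _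
    (fun b hb _ _ ↦ mul_mem_bimoduleSpan_left hb) (fun b hb _ _ ↦ mul_mem_bimoduleSpan_right hb)
    hαm hαp hdzw hdxw hdzy

end Relations

section Component

variable {K}
variable {q : K} {p : K[X]}

theorem isGWATuple_gwa (q : K) (p : K[X]) :
    IsGWATuple q p (xp K q p) (xm K q p) (zp K q p) (zm K q p) := by
  have key {a b : FreeAlgebra K (Fin 4)} (h : GWARel K q p a b) :
      RingQuot.mkAlgHom K (GWARel K q p) a = RingQuot.mkAlgHom K (GWARel K q p) b :=
    RingQuot.mkAlgHom_rel K h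
  constructor
  · simpa only [xp, xm, zp, zm, gwaGen, map_mul] using key .zz
  · simpa only [xp, xm, zp, zm, gwaGen, map_mul, map_smul] using key .xpzp
  · simpa only [xp, xm, zp, zm, gwaGen, map_mul, map_smul] using key .xpzm
  · simpa only [xp, xm, zp, zm, gwaGen, map_mul, map_smul] using key .xmzp
  · simpa only [xp, xm, zp, zm, gwaGen, map_mul, map_smul] using key .xmzm
  · simpa only [xp, xm, zp, zm, gwaGen, map_mul, ← aeval_algHom_apply] using key .xpxm
  · simpa only [xp, xm, zp, zm, gwaGen, map_mul, map_smul, ← aeval_algHom_apply] using key .xmxp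

theorem wordVal_mem_component (w : List (Fin 4)) :
    wordVal K q p w ∈ component K q p (wordDeg w) :=
  Submodule.subset_span ⟨w, rfl, rfl⟩

theorem one_mem_component_zero : (1 : GWA K q p) ∈ component K q p 0 :=
  wordVal_mem_component []

theorem gwaGen_mem_component (i : Fin 4) : gwaGen K q p i ∈ component K q p (gwaWt i) := by
  have := wordVal_mem_component (q := q) (p := p) [i]
  simpa only [wordVal, wordDeg, List.map_cons, List.map_nil, List.prod_cons, List.prod_nil,
    mul_one, List.sum_cons, List.sum_nil, add_zero] using this

theorem mem_component_of_eq {m n : ℤ} (h : m = n) {a : GWA K q p}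
    (ha : a ∈ component K q p m) : a ∈ component K q p n :=
  h ▸ ha

theorem mul_mem_component {m n : ℤ} {a b : GWA K q p} (ha : a ∈ component K q p m)
    (hb : b ∈ component K q p n) : a * b ∈ component K q p (m + n) := by
  have h := Submodule.mul_mem_mul ha hb
  rw [component, component, Submodule.span_mul_span] at h
  refine Submodule.span_mono ?_ h
  rintro _ ⟨_, ⟨u, rfl, rfl⟩, _, ⟨v, rfl, rfl⟩, rfl⟩
  exact ⟨u ++ v, by simp [wordDeg], by simp [wordVal]⟩

theorem pow_mem_component {n : ℤ} {a : GWA K q p} (ha : a ∈ component K q p n) (k : ℕ) :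
    a ^ k ∈ component K q p (k * n) := by
  induction k with
  | zero => simpa using one_mem_component_zero
  | succ k ih =>
    rw [pow_succ]
    exact mem_component_of_eq (by push_cast; ring) (mul_mem_component ih ha)

theorem xp_mem_component : xp K q p ∈ component K q p 1 := gwaGen_mem_component 0
theorem xm_mem_component : xm K q p ∈ component K q p (-1) := gwaGen_mem_component 1
theorem zp_mem_component : zp K q p ∈ component K q p 1 := gwaGen_mem_component 2
theorem zm_mem_component : zm K q p ∈ component K q p (-1) := gwaGen_mem_component 3

/-- The degree-zero subalgebra of `A(p;q)`. -/
def degreeZero (q : K) (p : K[X]) : Subalgebra K (GWA K q p) where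
  carrier := component K q p 0
  mul_mem' ha hb := by simpa using mul_mem_component ha hb
  add_mem' ha hb := add_mem ha hb
  algebraMap_mem' r := by
    rw [Algebra.algebraMap_eq_smul_one]
    exact Submodule.smul_mem _ _ one_mem_component_zero

theorem mem_degreeZero {a : GWA K q p} : a ∈ degreeZero q p ↔ a ∈ component K q p 0 :=
  Iff.rfl

theorem mul_mem_degreeZero {m n : ℤ} (h : m + n = 0) {a b : GWA K q p}
    (ha : a ∈ component K q p m) (hb : b ∈ component K q p n) : a * b ∈ degreeZero q p :=
  mem_degreeZero.2 (mem_component_of_eq h (mul_mem_component ha hb))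

theorem orderedSpan_le_component (n : ℤ) :
    orderedSpan K (xp K q p) (xm K q p) (zp K q p) (zm K q p) n ≤ component K q p n := by
  refine Submodule.span_le.2 ?_
  rintro _ ⟨i, j, k, ⟨hn, rfl⟩ | ⟨hn, rfl⟩⟩
  · exact mem_component_of_eq (by linarith) (mul_mem_component (mul_mem_component
      (pow_mem_component zp_mem_component i) (pow_mem_component zm_mem_component j))
      (pow_mem_component xp_mem_component k))
  · exact mem_component_of_eq (by linarith) (mul_mem_component (mul_mem_component
      (pow_mem_component zp_mem_component i) (pow_mem_component zm_mem_component j))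
      (pow_mem_component xm_mem_component k))

theorem component_le_orderedSpan (n : ℤ) :
    component K q p n ≤ orderedSpan K (xp K q p) (xm K q p) (zp K q p) (zm K q p) n := by
  refine Submodule.span_le.2 ?_
  rintro _ ⟨w, rfl, rfl⟩
  induction w with
  | nil =>
    change (1 : GWA K q p) ∈ orderedSpan K _ _ _ _ 0
    simpa using mem_orderedSpan_left (K := K) (x := xp K q p) (y := xm K q p) (z := zp K q p)
      (w := zm K q p) 0 0 0 (n := 0) (by simp)
  | cons i w ih =>
    obtain ⟨h0, h1, h2, h3⟩ := (isGWATuple_gwa q p).mul_mem_orderedSpan ih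
    fin_cases i
    · exact h0
    · exact h1
    · exact h2
    · exact h3

theorem component_two_le (hq : q ≠ 0) (T : Submodule K (GWA K q p))
    (hT : ∀ b ∈ component K q p 0, ∀ t ∈ T, b * t ∈ T)
    (hxx : xp K q p * xp K q p ∈ T) (hzx : zp K q p * xp K q p ∈ T)
    (hzz : zp K q p * zp K q p ∈ T) : component K q p 2 ≤ T :=
  (component_le_orderedSpan 2).trans <| (isGWATuple_gwa q p).orderedSpan_two_le hq T
    (fun b hb ↦ hT b (orderedSpan_le_component 0 hb)) hxx hzx hzz

theorem component_neg_two_le (hq : q ≠ 0) (T : Submodule K (GWA K q p))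
    (hT : ∀ b ∈ component K q p 0, ∀ t ∈ T, b * t ∈ T)
    (hxx : xm K q p * xm K q p ∈ T) (hzx : zm K q p * xm K q p ∈ T)
    (hzz : zm K q p * zm K q p ∈ T) : component K q p (-2) ≤ T := by
  have h := isGWATuple_gwa q p
  refine ((component_le_orderedSpan (-2)).trans (orderedSpan_neg_le_swap (K := K) h.zw 2)).trans ?_
  refine (h.swap hq).orderedSpan_two_le (inv_ne_zero hq) T (fun b hb ↦ hT b ?_) hxx hzx hzz
  have hb' := orderedSpan_neg_le_swap (K := K) (x := xm K q p) (y := xp K q p) h.zw.symm 0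
  rw [neg_zero] at hb'
  exact orderedSpan_le_component 0 (hb' hb)

theorem map_one_eq_zero_of_skew {A : Type*} [Ring A] [Algebra K A] (σ : A ≃ₐ[K] A)
    (D : A →ₗ[K] A) (hD : ∀ a b, D (a * b) = D a * σ b + a * D b) : D 1 = 0 := by
  simpa using hD 1 1

/-- A skew derivation that shifts the degrees of the generators by `s` shifts all degrees by
`s`. -/
theorem skewDerivation_mem_component (σ : GWA K q p ≃ₐ[K] GWA K q p)
    (hσ : ∀ (n : ℤ) (a : GWA K q p), a ∈ component K q p n → σ a = q ^ n • a)
    (D : GWA K q p →ₗ[K] GWA K q p) (hD : ∀ a b, D (a * b) = D a * σ b + a * D b) (s : ℤ)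
    (hxp : D (xp K q p) ∈ component K q p (1 + s)) (hxm : D (xm K q p) ∈ component K q p (-1 + s))
    (hzp : D (zp K q p) ∈ component K q p (1 + s)) (hzm : D (zm K q p) ∈ component K q p (-1 + s))
    {n : ℤ} {a : GWA K q p}
    (ha : a ∈ component K q p n) : D a ∈ component K q p (n + s) := by
  have hgen (i) : D (gwaGen K q p i) ∈ component K q p (gwaWt i + s) := by
    fin_cases i
    · exact hxp
    · exact hxm
    · exact hzp
    · exact hzm
  suffices h : component K q p n ≤ (component K q p (n + s)).comap D from h ha
  clear ha
  refine Submodule.span_le.2 ?_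
  rintro _ ⟨w, rfl, rfl⟩
  change D (wordVal K q p w) ∈ component K q p (wordDeg w + s)
  induction w with
  | nil =>
    change D (1 : GWA K q p) ∈ component K q p _
    rw [map_one_eq_zero_of_skew σ D hD]
    exact zero_mem _
  | cons i w ih =>
    have ev : wordVal K q p (i :: w) = gwaGen K q p i * wordVal K q p w := by simp [wordVal]
    have ed : wordDeg (i :: w) = gwaWt i + wordDeg w := by simp [wordDeg]
    rw [ev, ed, hD, hσ _ _ (wordVal_mem_component w), mul_smul_comm]
    refine add_mem (Submodule.smul_mem _ _ ?_) ?_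
    · exact mem_component_of_eq (by ring) (mul_mem_component (hgen i) (wordVal_mem_component w))
    · exact mem_component_of_eq (by ring)
        (mul_mem_component (gwaGen_mem_component i) ih)

theorem exists_degree_weight (hq : q ≠ 0) (α : K) : ∃ f : ℤ → K, f 0 = 0 ∧
    (∀ n, f (1 + n) = q ^ (2 * n) * α + f n) ∧
    ∀ n, f (-1 + n) = -(q ^ (-2 : ℤ) * α) * q ^ (2 * n) + f n := by
  suffices h : ∃ f : ℤ → K, f 0 = 0 ∧ ∀ n, f (1 + n) = q ^ (2 * n) * α + f n by
    obtain ⟨f, h0, h1⟩ := h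
    refine ⟨f, h0, h1, fun n ↦ ?_⟩
    have h2 := h1 (-1 + n)
    rw [add_neg_cancel_left, mul_add, zpow_add₀ hq, mul_neg_one] at h2
    linear_combination -h2
  by_cases h : q ^ 2 = 1
  · refine ⟨fun n ↦ n * α, by simp, fun n ↦ ?_⟩
    rw [zpow_mul, zpow_ofNat, h, one_zpow]
    push_cast
    ring
  · have h' : q ^ 2 - 1 ≠ 0 := sub_ne_zero.2 h
    refine ⟨fun n ↦ α * (q ^ (2 * n) - 1) / (q ^ 2 - 1), by simp, fun n ↦ ?_⟩
    simp only
    rw [mul_add, zpow_add₀ hq, mul_one, zpow_ofNat]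
    field_simp
    ring

theorem eq_zero_of_mem_component_zero (hq : q ≠ 0) (α : K)
    (σ : GWA K q p ≃ₐ[K] GWA K q p)
    (hσ : ∀ (n : ℤ) (a : GWA K q p), a ∈ component K q p n → σ a = q ^ (2 * n) • a)
    (D : GWA K q p →ₗ[K] GWA K q p) (hD : ∀ a b, D (a * b) = D a * σ b + a * D b)
    (hxp : D (xp K q p) = α • xp K q p)
    (hxm : D (xm K q p) = -(q ^ (-2 : ℤ) * α) • xm K q p)
    (hzp : D (zp K q p) = α • zp K q p)
    (hzm : D (zm K q p) = -(q ^ (-2 : ℤ) * α) • zm K q p)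
    {a : GWA K q p} (ha : a ∈ component K q p 0) : D a = 0 := by
  obtain ⟨f, h0, h1, h2⟩ := exists_degree_weight hq α
  have key (w : List (Fin 4)) : D (wordVal K q p w) = f (wordDeg w) • wordVal K q p w := by
    induction w with
    | nil =>
      change D 1 = f 0 • 1
      rw [map_one_eq_zero_of_skew σ D hD, h0, zero_smul]
    | cons i w ih =>
      have ev : wordVal K q p (i :: w) = gwaGen K q p i * wordVal K q p w := by simp [wordVal]
      have ed : wordDeg (i :: w) = gwaWt i + wordDeg w := by simp [wordDeg]
      have hg {β : K} (hβ : D (gwaGen K q p i) = β • gwaGen K q p i)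
          (hf : f (gwaWt i + wordDeg w) = β * q ^ (2 * wordDeg w) + f (wordDeg w)) :
          D (wordVal K q p (i :: w)) = f (wordDeg (i :: w)) • wordVal K q p (i :: w) := by
        rw [ev, ed, hf, hD, hβ, ih, hσ _ _ (wordVal_mem_component w), mul_comm β]
        simp only [smul_mul_assoc, mul_smul_comm, smul_smul, add_smul]
      have h1' := h1 (wordDeg w)
      rw [mul_comm _ α] at h1'
      fin_cases i
      · exact hg hxp h1'
      · exact hg hxm (h2 _)
      · exact hg hzp h1'
      · exact hg hzm (h2 _)
  suffices h : component K q p 0 ≤ LinearMap.ker D from h ha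
  refine Submodule.span_le.2 ?_
  rintro _ ⟨w, hw, rfl⟩
  rw [SetLike.mem_coe, LinearMap.mem_ker, key, hw, h0, zero_smul]

end Component

/-- The calculus `Ω̄ = B·d(B)·B` induced on the degree-zero subalgebra
`B = A(p;q)₀` equals `A(p;q)₂·ω₋ ⊕ A(p;q)₋₂·ω₊` inside `Ω`. -/
theorem restricted_calculus_on_B [CharZero K]
    (q : K) (hq : q ≠ 0) (p : K[X])
    (α0 αm αp : K)
    (σm : GWA K q p ≃ₐ[K] GWA K q p)
    (hσm : ∀ (n : ℤ) (a : GWA K q p), a ∈ component K q p n → σm a = q ^ n • a)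
    (σ0 : GWA K q p ≃ₐ[K] GWA K q p)
    (hσ0 : ∀ (n : ℤ) (a : GWA K q p), a ∈ component K q p n → σ0 a = q ^ (2 * n) • a)
    (D0 Dm Dp : GWA K q p →ₗ[K] GWA K q p)
    (hD0leib : ∀ a b, D0 (a * b) = D0 a * σ0 b + a * D0 b)
    (hD0xp : D0 (xp K q p) = α0 • xp K q p)
    (hD0xm : D0 (xm K q p) = -(q ^ (-2 : ℤ) * α0) • xm K q p)
    (hD0zp : D0 (zp K q p) = α0 • zp K q p)
    (hD0zm : D0 (zm K q p) = -(q ^ (-2 : ℤ) * α0) • zm K q p)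
    (hDmleib : ∀ a b, Dm (a * b) = Dm a * σm b + a * Dm b)
    (hDmxp : Dm (xp K q p) = 0)
    (hDmzp : Dm (zp K q p) = 0)
    (hDmxm : Dm (xm K q p) = αm • (aeval (zp K q p * zm K q p) (cPoly K q p) * zp K q p))
    (hDmzm : Dm (zm K q p) = αm • xp K q p)
    (hDpleib : ∀ a b, Dp (a * b) = Dp a * σm b + a * Dp b)
    (hDpxm : Dp (xm K q p) = 0)
    (hDpzm : Dp (zm K q p) = 0)
    (hDpxp : Dp (xp K q p) = αp • (aeval (zp K q p * zm K q p) (cPoly K q p) * zm K q p))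
    (hDpzp : Dp (zp K q p) = αp • xm K q p)
    (hsep : QSeparable K q p)
    (hα0 : α0 ≠ 0) (hαm : αm ≠ 0) (hαp : αp ≠ 0)
    (hq4 : q ^ 4 ≠ 1 ∨ p.natDegree ≤ 1) :
    Submodule.span K {ω : Fin 3 → GWA K q p |
        ∃ a ∈ component K q p 0, ∃ b ∈ component K q p 0, ∃ c ∈ component K q p 0,
          ω = rAct K q p σm σ0 (a • ![Dm b, D0 b, Dp b]) c}
      = Submodule.pi Set.univ ![component K q p 2, ⊥, component K q p (-2)] := by
  have hB (c) (hc : c ∈ component K q p 0) : σm c = c := by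
    rw [hσm 0 c hc, zpow_zero, one_smul]
  have hB0 (b) (hb : b ∈ component K q p 0) : D0 b = 0 :=
    eq_zero_of_mem_component_zero hq α0 σ0 hσ0 D0 hD0leib hD0xp hD0xm hD0zp hD0zm hb
  have hgen (a b c) (hb : b ∈ component K q p 0) (hc : c ∈ component K q p 0) :
      rAct K q p σm σ0 (a • ![Dm b, D0 b, Dp b]) c = ![a * Dm b * c, 0, a * Dp b * c] := by
    simp [rAct, hB c hc, hB0 b hb]
  have hc0 : aeval (zp K q p * zm K q p) (cPoly K q p) ∈ component K q p 0 :=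
    Algebra.adjoin_le (S := degreeZero q p)
      (Set.singleton_subset_iff.2
        (mul_mem_degreeZero (by norm_num) zp_mem_component zm_mem_component))
      (aeval_mem_adjoin_singleton K _)
  have hDm2 (b) (hb : b ∈ component K q p 0) : Dm b ∈ component K q p 2 := by
    refine mem_component_of_eq (zero_add _)
      (skewDerivation_mem_component σm hσm Dm hDmleib 2 ?_ ?_ ?_ ?_ hb)
    · rw [hDmxp]
      exact zero_mem _
    · rw [hDmxm]
      exact Submodule.smul_mem _ _ (mem_component_of_eq (by norm_num)
        (mul_mem_component hc0 zp_mem_component))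
    · rw [hDmzp]
      exact zero_mem _
    · rw [hDmzm]
      exact Submodule.smul_mem _ _ (mem_component_of_eq (by norm_num) xp_mem_component)
  have hDp2 (b) (hb : b ∈ component K q p 0) : Dp b ∈ component K q p (-2) := by
    refine mem_component_of_eq (zero_add _)
      (skewDerivation_mem_component σm hσm Dp hDpleib (-2) ?_ ?_ ?_ ?_ hb)
    · rw [hDpxp]
      exact Submodule.smul_mem _ _ (mem_component_of_eq (by norm_num)
        (mul_mem_component hc0 zm_mem_component))
    · rw [hDpxm]
      exact zero_mem _
    · rw [hDpzp]
      exact Submodule.smul_mem _ _ (mem_component_of_eq (by norm_num) xm_mem_component)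
    · rw [hDpzm]
      exact zero_mem _
  apply le_antisymm
  · refine Submodule.span_le.2 ?_
    rintro _ ⟨a, ha, b, hb, c, hc, rfl⟩
    rw [hgen a b c hb hc, SetLike.mem_coe, Submodule.mem_pi]
    intro i _
    fin_cases i
    · exact mem_component_of_eq (by norm_num)
        (mul_mem_component (mul_mem_component ha (hDm2 b hb)) hc)
    · exact zero_mem _
    · exact mem_component_of_eq (by norm_num)
        (mul_mem_component (mul_mem_component ha (hDp2 b hb)) hc)
  have hσ1 (a) (ha : a ∈ component K q p (-1)) : σm a = q⁻¹ • a := by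
    rw [hσm _ _ ha, zpow_neg_one]
  obtain ⟨⟨h1, h2, h3⟩, h4, h5, h6⟩ :=
    (isGWATuple_gwa q p).quadratic_mem_bimoduleSpan hq hsep hq4 (degreeZero q p)
      (mul_mem_degreeZero (by norm_num) zp_mem_component zm_mem_component)
      (mul_mem_degreeZero (by norm_num) zp_mem_component xm_mem_component)
      (mul_mem_degreeZero (by norm_num) xp_mem_component zm_mem_component) hαm hαp σm
      (hσ1 _ xm_mem_component) (hσ1 _ zm_mem_component) Dm Dp hDmleib hDmxp hDmzp hDmxm hDmzm
      hDpleib hDpxm hDpzm hDpxp hDpzp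
  have hm := component_two_le hq ((bimoduleSpan (degreeZero q p) Dm Dp).comap (LinearMap.inl K _ _))
    (fun b hb t ht ↦ by simpa using mul_mem_bimoduleSpan_left (B := degreeZero q p) hb ht) h2 h1 h3
  have hp := component_neg_two_le hq
    ((bimoduleSpan (degreeZero q p) Dm Dp).comap (LinearMap.inr K _ _))
    (fun b hb t ht ↦ by simpa using mul_mem_bimoduleSpan_left (B := degreeZero q p) hb ht) h5 h4 h6
  let ι : GWA K q p × GWA K q p →ₗ[K] (Fin 3 → GWA K q p) :=
    { toFun := fun t ↦ ![t.1, 0, t.2]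
      map_add' := fun s t ↦ by simp
      map_smul' := fun r t ↦ by simp }
  intro ω hω
  rw [Submodule.mem_pi] at hω
  have e : ω = ι (ω 0, ω 2) := by
    funext i
    fin_cases i
    · rfl
    · exact hω 1 (Set.mem_univ _)
    · rfl
  have hω' : (ω 0, ω 2) ∈ bimoduleSpan (degreeZero q p) Dm Dp := by
    have hω0 : (ω 0, 0) ∈ bimoduleSpan (degreeZero q p) Dm Dp := hm (hω 0 (Set.mem_univ _))
    have hω2 : ω 2 ∈ component K q p (-2) := hω 2 (Set.mem_univ _)
    have hω2' : (0, ω 2) ∈ bimoduleSpan (degreeZero q p) Dm Dp := Submodule.mem_comap.1 (hp hω2)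
    simpa using add_mem hω0 hω2'
  rw [e, ← Submodule.mem_comap]
  refine (Submodule.span_le.2 ?_ : bimoduleSpan (degreeZero q p) Dm Dp ≤ _) hω'
  rintro _ ⟨a, ha, b, hb, c, hc, rfl⟩
  exact Submodule.subset_span ⟨a, ha, b, hb, c, hc, (hgen a b c hb hc).symm⟩

end GWAPaper
end
end

section
/- Let K = ℂ, let q be a real number with 0 < q < 1, let p have real coefficients, and equip A(p;q) with its *-structure determined by z₋* = z₊ and x₋* = x₊. Assume α₀ ∈ ℝ and conj(α₋) = q·α₊. Then for every homogeneous element c ∈ A(p;q) of degree k: (∂₊(c))* = q^{k−2}·∂₋(c*) and (∂₋(c))* = q^{k+2}·∂₊(c*). -/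
noncomputable section

open Polynomial
open scoped Classical

namespace GWAPaper

variable (K : Type) [Field K]

/-- `cPoly` commutes with extension of scalars from `ℝ` to `ℂ`. -/
lemma cPoly_map (q : ℝ) (p : ℝ[X]) :
    cPoly ℂ (q : ℂ) (p.map (algebraMap ℝ ℂ)) = (cPoly ℝ q p).map (algebraMap ℝ ℂ) := by
  have h : ((q : ℂ) ^ 2 = 1) ↔ q ^ 2 = 1 := by norm_cast
  by_cases hq : q ^ 2 = 1
  · simp [cPoly, qDeriv, hq, h.2 hq, Polynomial.derivative_map]
  · have hq' : ¬ (q : ℂ) ^ 2 = 1 := fun hc => hq (h.1 hc)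
    simp [cPoly, qDeriv, hq, hq', Polynomial.map_div, Polynomial.map_comp]

/-- A conjugate-linear anti-multiplicative map fixing `1` and `z` fixes every real polynomial
in `z`. -/
lemma star_aeval_map_real {A : Type*} [Ring A] [Algebra ℂ A] (st : A → A)
    (hadd : ∀ a b, st (a + b) = st a + st b)
    (hsmul : ∀ (k : ℂ) (a : A), st (k • a) = (starRingEnd ℂ) k • st a)
    (hmul : ∀ a b, st (a * b) = st b * st a) (hone : st 1 = 1)
    (z : A) (hz : st z = z) (r : ℝ[X]) :
    st (aeval z (r.map (algebraMap ℝ ℂ))) = aeval z (r.map (algebraMap ℝ ℂ)) := by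
  have hpow : ∀ n : ℕ, st (z ^ n) = z ^ n := by
    intro n
    induction n with
    | zero => simpa using hone
    | succ n ih => rw [pow_succ, hmul, ih, hz, ← pow_succ', pow_succ]
  induction r using Polynomial.induction_on' with
  | add f g hf hg => simp only [Polynomial.map_add, map_add, hadd, hf, hg]
  | monomial n a =>
    rw [Polynomial.map_monomial, Polynomial.aeval_monomial, ← Algebra.smul_def, hsmul, hpow]
    simp

/-- If the `q`-twisted compatibility `(D a)* = q ^ (m + e) • D' (a*)` between two skew derivations
holds for `a` of degree `m` and for `b` of degree `n`, it holds for `a * b`. -/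
lemma star_skewDerivation_mul {A : Type*} [Ring A] [Algebra ℂ A] {q : ℝ} (hq : (q : ℂ) ≠ 0)
    (σ st D D' : A → A)
    (hadd : ∀ a b, st (a + b) = st a + st b)
    (hsmul : ∀ (k : ℂ) (a : A), st (k • a) = (starRingEnd ℂ) k • st a)
    (hmul : ∀ a b, st (a * b) = st b * st a)
    (hD : ∀ a b, D (a * b) = D a * σ b + a * D b)
    (hD' : ∀ a b, D' (a * b) = D' a * σ b + a * D' b)
    {m n e : ℤ} {a b : A}
    (hσa : σ (st a) = (q : ℂ) ^ (-m) • st a) (hσb : σ b = (q : ℂ) ^ n • b)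
    (ha : st (D a) = (q : ℂ) ^ (m + e) • D' (st a))
    (hb : st (D b) = (q : ℂ) ^ (n + e) • D' (st b)) :
    st (D (a * b)) = (q : ℂ) ^ (m + n + e) • D' (st (a * b)) := by
  have hconj : (starRingEnd ℂ) ((q : ℂ) ^ n) = (q : ℂ) ^ n := by simp
  rw [hD, hadd, hmul, hmul, hσb, hsmul, hconj, ha, hb, hmul, hD', hσa]
  simp only [smul_add, smul_mul_assoc, mul_smul_comm, smul_smul, ← zpow_add₀ hq]
  rw [add_comm]
  congr 3 <;> ring

/-- The `q`-twisted compatibility of two skew derivations extends from the generators to every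
homogeneous element. -/
lemma star_skewDerivation_of_gen {q : ℝ} (hq : (q : ℂ) ≠ 0) {p : ℂ[X]}
    (σ D D' : GWA ℂ (q : ℂ) p →ₗ[ℂ] GWA ℂ (q : ℂ) p)
    (hσ : ∀ (n : ℤ), ∀ a ∈ component ℂ (q : ℂ) p n, σ a = (q : ℂ) ^ n • a)
    (st : GWA ℂ (q : ℂ) p → GWA ℂ (q : ℂ) p)
    (hadd : ∀ a b, st (a + b) = st a + st b)
    (hsmul : ∀ (k : ℂ) (a : GWA ℂ (q : ℂ) p), st (k • a) = (starRingEnd ℂ) k • st a)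
    (hmul : ∀ a b, st (a * b) = st b * st a) (hone : st 1 = 1)
    (hD : ∀ a b, D (a * b) = D a * σ b + a * D b)
    (hD' : ∀ a b, D' (a * b) = D' a * σ b + a * D' b)
    (e : ℤ)
    (hst : ∀ i, σ (st (gwaGen ℂ (q : ℂ) p i)) =
      (q : ℂ) ^ (-gwaWt i) • st (gwaGen ℂ (q : ℂ) p i))
    (hgen : ∀ i, st (D (gwaGen ℂ (q : ℂ) p i)) =
      (q : ℂ) ^ (gwaWt i + e) • D' (st (gwaGen ℂ (q : ℂ) p i)))
    (k : ℤ) (c : GWA ℂ (q : ℂ) p) (hc : c ∈ component ℂ (q : ℂ) p k) :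
    st (D c) = (q : ℂ) ^ (k + e) • D' (st c) := by
  have hzero : st 0 = 0 := by simpa using hsmul 0 0
  have hσ1 : σ 1 = 1 := by
    simpa using hσ 0 1 (Submodule.subset_span ⟨[], by simp [wordDeg], by simp [wordVal]⟩)
  have hD1 : D 1 = 0 := by simpa [hσ1] using hD 1 1
  have hD1' : D' 1 = 0 := by simpa [hσ1] using hD' 1 1
  have hword : ∀ w : List (Fin 4), st (D (wordVal ℂ (q : ℂ) p w)) =
      (q : ℂ) ^ (wordDeg w + e) • D' (st (wordVal ℂ (q : ℂ) p w)) := by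
    intro w
    induction w with
    | nil => simp [wordVal, hD1, hD1', hone, hzero]
    | cons i w ih =>
      have hval : wordVal ℂ (q : ℂ) p (i :: w) =
          gwaGen ℂ (q : ℂ) p i * wordVal ℂ (q : ℂ) p w := by simp [wordVal]
      have hdeg : wordDeg (i :: w) = gwaWt i + wordDeg w := by simp [wordDeg]
      rw [hval, hdeg]
      exact star_skewDerivation_mul hq σ st D D' hadd hsmul hmul hD hD' (hst i)
        (hσ _ _ (Submodule.subset_span ⟨w, rfl, rfl⟩)) (hgen i) ih
  induction hc using Submodule.span_induction with
  | mem x hx =>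
    obtain ⟨w, rfl, rfl⟩ := hx
    exact hword w
  | zero => simp [hzero]
  | add x y _ _ hx hy => rw [map_add, hadd, hx, hy, hadd, map_add, smul_add]
  | smul t x _ hx => rw [map_smul, hsmul, hx, hsmul, map_smul, smul_comm]

/-- Over `ℂ`, with the `*`-structure `z₋* = z₊`, `x₋* = x₊` on `A(p;q)`,
`α₀ ∈ ℝ` and `conj(α₋) = q·α₊`, every homogeneous `c` of degree `k` satisfies
`(∂₊(c))* = q^{k−2}·∂₋(c*)` and `(∂₋(c))* = q^{k+2}·∂₊(c*)`. -/
theorem star_compatibility_of_skew_derivations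
    (q : ℝ) (hq0 : 0 < q) (hq1 : q < 1) (p : Polynomial ℝ)
    (α0 : ℝ) (αm αp : ℂ) (hα : (starRingEnd ℂ) αm = (q : ℂ) * αp)
    (σm : GWA ℂ (q : ℂ) (p.map (algebraMap ℝ ℂ)) ≃ₐ[ℂ] GWA ℂ (q : ℂ) (p.map (algebraMap ℝ ℂ)))
    (hσm : ∀ (n : ℤ) (a : GWA ℂ (q : ℂ) (p.map (algebraMap ℝ ℂ))), a ∈ component ℂ (q : ℂ) (p.map (algebraMap ℝ ℂ)) n → σm a = (q : ℂ) ^ n • a)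
    (Dm Dp : GWA ℂ (q : ℂ) (p.map (algebraMap ℝ ℂ)) →ₗ[ℂ] GWA ℂ (q : ℂ) (p.map (algebraMap ℝ ℂ)))
    (hDmleib : ∀ a b, Dm (a * b) = Dm a * σm b + a * Dm b)
    (hDmxp : Dm (xp ℂ (q : ℂ) (p.map (algebraMap ℝ ℂ))) = 0)
    (hDmzp : Dm (zp ℂ (q : ℂ) (p.map (algebraMap ℝ ℂ))) = 0)
    (hDmxm : Dm (xm ℂ (q : ℂ) (p.map (algebraMap ℝ ℂ))) = αm • (aeval (zp ℂ (q : ℂ) (p.map (algebraMap ℝ ℂ)) * zm ℂ (q : ℂ) (p.map (algebraMap ℝ ℂ))) (cPoly ℂ (q : ℂ) (p.map (algebraMap ℝ ℂ))) * zp ℂ (q : ℂ) (p.map (algebraMap ℝ ℂ))))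
    (hDmzm : Dm (zm ℂ (q : ℂ) (p.map (algebraMap ℝ ℂ))) = αm • xp ℂ (q : ℂ) (p.map (algebraMap ℝ ℂ)))
    (hDpleib : ∀ a b, Dp (a * b) = Dp a * σm b + a * Dp b)
    (hDpxm : Dp (xm ℂ (q : ℂ) (p.map (algebraMap ℝ ℂ))) = 0)
    (hDpzm : Dp (zm ℂ (q : ℂ) (p.map (algebraMap ℝ ℂ))) = 0)
    (hDpxp : Dp (xp ℂ (q : ℂ) (p.map (algebraMap ℝ ℂ))) = αp • (aeval (zp ℂ (q : ℂ) (p.map (algebraMap ℝ ℂ)) * zm ℂ (q : ℂ) (p.map (algebraMap ℝ ℂ))) (cPoly ℂ (q : ℂ) (p.map (algebraMap ℝ ℂ))) * zm ℂ (q : ℂ) (p.map (algebraMap ℝ ℂ))))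
    (hDpzp : Dp (zp ℂ (q : ℂ) (p.map (algebraMap ℝ ℂ))) = αp • xm ℂ (q : ℂ) (p.map (algebraMap ℝ ℂ)))
    (st : GWA ℂ (q : ℂ) (p.map (algebraMap ℝ ℂ)) → GWA ℂ (q : ℂ) (p.map (algebraMap ℝ ℂ)))
    (hst_add : ∀ a b, st (a + b) = st a + st b)
    (hst_smul : ∀ (k : ℂ) (a : GWA ℂ (q : ℂ) (p.map (algebraMap ℝ ℂ))), st (k • a) = (starRingEnd ℂ) k • st a)
    (hst_mul : ∀ a b, st (a * b) = st b * st a)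
    (hst_invol : ∀ a, st (st a) = a)
    (hst_zm : st (zm ℂ (q : ℂ) (p.map (algebraMap ℝ ℂ))) = zp ℂ (q : ℂ) (p.map (algebraMap ℝ ℂ)))
    (hst_zp : st (zp ℂ (q : ℂ) (p.map (algebraMap ℝ ℂ))) = zm ℂ (q : ℂ) (p.map (algebraMap ℝ ℂ)))
    (hst_xm : st (xm ℂ (q : ℂ) (p.map (algebraMap ℝ ℂ))) = xp ℂ (q : ℂ) (p.map (algebraMap ℝ ℂ)))
    (hst_xp : st (xp ℂ (q : ℂ) (p.map (algebraMap ℝ ℂ))) = xm ℂ (q : ℂ) (p.map (algebraMap ℝ ℂ)))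
    :
    ∀ (k : ℤ), ∀ c ∈ component ℂ (q : ℂ) (p.map (algebraMap ℝ ℂ)) k,
      st (Dp c) = ((q : ℂ) ^ (k - 2)) • Dm (st c) ∧
      st (Dm c) = ((q : ℂ) ^ (k + 2)) • Dp (st c) := by
  have hq : (q : ℂ) ≠ 0 := by exact_mod_cast hq0.ne'
  have hone : st 1 = 1 := by
    have h := hst_mul (st 1) 1
    rw [mul_one, hst_invol, mul_one] at h
    exact h.symm
  have hzero : st 0 = 0 := by simpa using hst_smul 0 0
  have hα' : (starRingEnd ℂ) αp = (q : ℂ)⁻¹ * αm := by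
    have h := congrArg (starRingEnd ℂ) hα
    rw [Complex.conj_conj, map_mul, Complex.conj_ofReal] at h
    rw [h, inv_mul_cancel_left₀ hq]
  have hcomm : zp ℂ (q : ℂ) (p.map (algebraMap ℝ ℂ)) * zm ℂ (q : ℂ) (p.map (algebraMap ℝ ℂ)) =
      zm ℂ (q : ℂ) (p.map (algebraMap ℝ ℂ)) * zp ℂ (q : ℂ) (p.map (algebraMap ℝ ℂ)) := by
    simpa [zp, zm, gwaGen] using
      RingQuot.mkAlgHom_rel ℂ (GWARel.zz (K := ℂ) (q := (q : ℂ)) (p := p.map (algebraMap ℝ ℂ)))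
  have hσgen : ∀ i, σm (gwaGen ℂ (q : ℂ) (p.map (algebraMap ℝ ℂ)) i) =
      (q : ℂ) ^ gwaWt i • gwaGen ℂ (q : ℂ) (p.map (algebraMap ℝ ℂ)) i := fun i =>
    hσm _ _ (Submodule.subset_span ⟨[i], by simp [wordDeg], by simp [wordVal]⟩)
  have hC : st (aeval (zp ℂ (q : ℂ) (p.map (algebraMap ℝ ℂ)) *
      zm ℂ (q : ℂ) (p.map (algebraMap ℝ ℂ))) (cPoly ℂ (q : ℂ) (p.map (algebraMap ℝ ℂ)))) =
      aeval (zp ℂ (q : ℂ) (p.map (algebraMap ℝ ℂ)) *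
        zm ℂ (q : ℂ) (p.map (algebraMap ℝ ℂ))) (cPoly ℂ (q : ℂ) (p.map (algebraMap ℝ ℂ))) := by
    rw [cPoly_map]
    exact star_aeval_map_real st hst_add hst_smul hst_mul hone _
      (by rw [hst_mul, hst_zm, hst_zp]) _
  have hcommC : ∀ y, Commute (zp ℂ (q : ℂ) (p.map (algebraMap ℝ ℂ)) *
      zm ℂ (q : ℂ) (p.map (algebraMap ℝ ℂ))) y → ∀ r : ℂ[X],
      y * aeval (zp ℂ (q : ℂ) (p.map (algebraMap ℝ ℂ)) *
        zm ℂ (q : ℂ) (p.map (algebraMap ℝ ℂ))) r =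
      aeval (zp ℂ (q : ℂ) (p.map (algebraMap ℝ ℂ)) *
        zm ℂ (q : ℂ) (p.map (algebraMap ℝ ℂ))) r * y := by
    intro y hy r
    induction r using Polynomial.induction_on' with
    | add f g hf hg => rw [map_add, mul_add, add_mul, hf, hg]
    | monomial n a =>
      rw [Polynomial.aeval_monomial, ← Algebra.smul_def, mul_smul_comm, smul_mul_assoc,
        (hy.pow_left n).eq]
  have hCp := hcommC (zp ℂ (q : ℂ) (p.map (algebraMap ℝ ℂ)))
    ((Commute.refl _).mul_left hcomm.symm) (cPoly ℂ (q : ℂ) (p.map (algebraMap ℝ ℂ)))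
  have hCm := hcommC (zm ℂ (q : ℂ) (p.map (algebraMap ℝ ℂ)))
    (Commute.mul_left hcomm (Commute.refl _)) (cPoly ℂ (q : ℂ) (p.map (algebraMap ℝ ℂ)))
  have hst : ∀ i, σm (st (gwaGen ℂ (q : ℂ) (p.map (algebraMap ℝ ℂ)) i)) =
      (q : ℂ) ^ (-gwaWt i) • st (gwaGen ℂ (q : ℂ) (p.map (algebraMap ℝ ℂ)) i) := by
    intro i
    fin_cases i
    · change σm (st (xp ℂ (q : ℂ) _)) = _ • st (xp ℂ (q : ℂ) _)
      rw [hst_xp]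
      exact hσgen 1
    · change σm (st (xm ℂ (q : ℂ) _)) = _ • st (xm ℂ (q : ℂ) _)
      rw [hst_xm]
      exact hσgen 0
    · change σm (st (zp ℂ (q : ℂ) _)) = _ • st (zp ℂ (q : ℂ) _)
      rw [hst_zp]
      exact hσgen 3
    · change σm (st (zm ℂ (q : ℂ) _)) = _ • st (zm ℂ (q : ℂ) _)
      rw [hst_zm]
      exact hσgen 2
  intro k c hc
  constructor
  · refine star_skewDerivation_of_gen hq σm.toLinearMap Dp Dm hσm st hst_add hst_smul hst_mul hone
      hDpleib hDmleib (-2) hst ?_ k c hc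
    intro i
    fin_cases i
    · change st (Dp (xp ℂ (q : ℂ) _)) = (q : ℂ) ^ ((1 : ℤ) + (-2)) • Dm (st (xp ℂ (q : ℂ) _))
      rw [hst_xp, hDpxp, hDmxm, hst_smul, hst_mul, hC, hst_zm, hCp, hα', smul_smul]
      norm_num
    · change st (Dp (xm ℂ (q : ℂ) _)) = (q : ℂ) ^ ((-1 : ℤ) + (-2)) • Dm (st (xm ℂ (q : ℂ) _))
      rw [hst_xm, hDpxm, hDmxp, hzero, smul_zero]
    · change st (Dp (zp ℂ (q : ℂ) _)) = (q : ℂ) ^ ((1 : ℤ) + (-2)) • Dm (st (zp ℂ (q : ℂ) _))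
      rw [hst_zp, hDpzp, hDmzm, hst_smul, hst_xm, hα', smul_smul]
      norm_num
    · change st (Dp (zm ℂ (q : ℂ) _)) = (q : ℂ) ^ ((-1 : ℤ) + (-2)) • Dm (st (zm ℂ (q : ℂ) _))
      rw [hst_zm, hDpzm, hDmzp, hzero, smul_zero]
  · refine star_skewDerivation_of_gen hq σm.toLinearMap Dm Dp hσm st hst_add hst_smul hst_mul hone
      hDmleib hDpleib 2 hst ?_ k c hc
    intro i
    fin_cases i
    · change st (Dm (xp ℂ (q : ℂ) _)) = (q : ℂ) ^ ((1 : ℤ) + 2) • Dp (st (xp ℂ (q : ℂ) _))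
      rw [hst_xp, hDmxp, hDpxm, hzero, smul_zero]
    · change st (Dm (xm ℂ (q : ℂ) _)) = (q : ℂ) ^ ((-1 : ℤ) + 2) • Dp (st (xm ℂ (q : ℂ) _))
      rw [hst_xm, hDmxm, hDpxp, hst_smul, hst_mul, hC, hst_zp, hCm, hα, smul_smul]
      norm_num
    · change st (Dm (zp ℂ (q : ℂ) _)) = (q : ℂ) ^ ((1 : ℤ) + 2) • Dp (st (zp ℂ (q : ℂ) _))
      rw [hst_zp, hDmzp, hDpzm, hzero, smul_zero]
    · change st (Dm (zm ℂ (q : ℂ) _)) = (q : ℂ) ^ ((-1 : ℤ) + 2) • Dp (st (zm ℂ (q : ℂ) _))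
      rw [hst_zm, hDmzm, hDpzp, hst_smul, hst_xp, hα, smul_smul]
      norm_num

end GWAPaper
end
end
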